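/- arXiv:1608.05540 — 8 statements merged into one kernel-verified Lean document; each statement's English description precedes it below -/
import Mathlib

section
/- Let (Ω, F, ν) be a probability space, let σ : Ω → Ω be a measurable map which preserves ν (i.e. ν(σ⁻¹A) = ν(A) for all measurable A), and let φ, ζ : Ω → ℝ be measurable functions such that ζ is ν-integrable and such that φ∘σ − φ ≥ −ζ holds ν-almost everywhere. Then φ∘σ − φ is ν-integrable and ∫_Ω (φ∘σ − φ) dν = 0. -/
open MeasureTheory Filter Topology

/-- Truncation of a real number to the interval `[-n, n]`. -/
noncomputable def truncate (n : ℕ) (x : ℝ) : ℝ := max (-n) (min x n)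

theorem measurable_truncate (n : ℕ) : Measurable (truncate n) := by
  unfold truncate; fun_prop

theorem abs_truncate_le (n : ℕ) (x : ℝ) : |truncate n x| ≤ n := by
  have hn : (0 : ℝ) ≤ n := n.cast_nonneg
  exact abs_le.2 ⟨le_max_left _ _, max_le (by linarith) (min_le_right _ _)⟩

theorem truncate_mono (n : ℕ) : Monotone (truncate n) := fun _ _ hxy =>
  max_le_max le_rfl (min_le_min hxy le_rfl)

theorem abs_truncate_sub_le (n : ℕ) (x y : ℝ) : |truncate n x - truncate n y| ≤ |x - y| := by
  unfold truncate
  calc _ ≤ |min x n - min y n| := by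
        simpa [max_comm] using abs_max_sub_max_le_abs (min x n) (min y n) (-n : ℝ)
    _ ≤ |x - y| := by simpa using abs_min_sub_min_le_max x n y n

theorem tendsto_truncate (x : ℝ) : Tendsto (fun n => truncate n x) atTop (𝓝 x) := by
  refine tendsto_const_nhds.congr' ?_
  obtain ⟨N, hN⟩ := exists_nat_ge |x|
  filter_upwards [eventually_ge_atTop N] with n hn
  have hxn : |x| ≤ n := hN.trans (by exact_mod_cast hn)
  rw [truncate, min_eq_left (abs_le.1 hxn).2, max_eq_right (abs_le.1 hxn).1]

theorem neg_abs_le_truncate_sub (n : ℕ) {x y z : ℝ} (h : -z ≤ x - y) :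
    -|z| ≤ truncate n x - truncate n y := by
  rcases le_total y x with hxy | hxy
  · linarith [truncate_mono n hxy, abs_nonneg z]
  · have := neg_abs_le (truncate n x - truncate n y)
    have := abs_truncate_sub_le n x y
    rw [abs_of_nonpos (sub_nonpos.2 hxy)] at this
    linarith [le_abs_self z]

section

variable {Ω : Type*} [MeasurableSpace Ω] {ν : Measure Ω}

theorem integrable_truncate_comp [IsFiniteMeasure ν] {φ : Ω → ℝ} (hφ : Measurable φ) (n : ℕ) :
    Integrable (fun u => truncate n (φ u)) ν :=
  .of_bound ((measurable_truncate n).comp hφ).aestronglyMeasurable n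
    (ae_of_all _ fun _ => abs_truncate_le _ _)

theorem MeasureTheory.MeasurePreserving.integral_comp_sub_eq_zero {σ : Ω → Ω}
    (hσ : MeasurePreserving σ ν ν) {f : Ω → ℝ} (hf : Integrable f ν) :
    ∫ u, (f (σ u) - f u) ∂ν = 0 := by
  have hfσ : ∫ u, f (σ u) ∂ν = ∫ u, f u ∂ν := by
    have := integral_map hσ.aemeasurable (f := f) (by simpa [hσ.map_eq] using hf.1)
    rw [← this, hσ.map_eq]
  have hi : Integrable (fun u => f (σ u)) ν := hσ.integrable_comp_of_integrable hf
  rw [integral_sub hi hf, hfσ, sub_self]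

/-- A consequence of Fatou's lemma: an almost everywhere limit of integrable functions that have
zero integral and a common integrable lower bound is integrable. -/
theorem integrable_of_tendsto_of_integral_eq_zero {F : ℕ → Ω → ℝ} {f b : Ω → ℝ}
    (hF : ∀ n, Integrable (F n) ν) (hF0 : ∀ n, ∫ u, F n u ∂ν = 0) (hb : Integrable b ν)
    (hbF : ∀ n, ∀ᵐ u ∂ν, -b u ≤ F n u)
    (hlim : ∀ᵐ u ∂ν, Tendsto (fun n => F n u) atTop (𝓝 (f u))) : Integrable f ν := by
  have hnn : ∀ n, 0 ≤ᵐ[ν] fun u => F n u + b u := fun n => by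
    filter_upwards [hbF n] with u hu
    simp only [Pi.zero_apply]; linarith
  have key : Integrable (fun u => f u + b u) ν := by
    have hsm : ∀ n, AEStronglyMeasurable (fun u => F n u + b u) ν := fun n =>
      ((hF n).add hb).aestronglyMeasurable
    have hlim' : ∀ᵐ u ∂ν, Tendsto (fun n => F n u + b u) atTop (𝓝 (f u + b u)) := by
      filter_upwards [hlim] with u hu using hu.add_const _
    refine ⟨aestronglyMeasurable_of_tendsto_ae _ hsm hlim', ?_⟩
    calc ∫⁻ u, ‖f u + b u‖ₑ ∂ν = ∫⁻ u, liminf (fun n => ‖F n u + b u‖ₑ) atTop ∂ν :=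
          lintegral_congr_ae (by filter_upwards [hlim'] with u hu using hu.enorm.liminf_eq.symm)
      _ ≤ liminf (fun n => ∫⁻ u, ‖F n u + b u‖ₑ ∂ν) atTop :=
          lintegral_liminf_le' fun n => (hsm n).aemeasurable.enorm
      _ < ⊤ := ?_
    have hint : ∀ n, ∫⁻ u, ‖F n u + b u‖ₑ ∂ν = ENNReal.ofReal (∫ u, b u ∂ν) := fun n => by
      have := integral_add (hF n) hb
      rw [hF0, zero_add] at this
      have hi : Integrable (fun u => F n u + b u) ν := (hF n).add hb
      rw [← this, ofReal_integral_eq_lintegral_ofReal hi (hnn n)]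
      refine lintegral_congr_ae ?_
      filter_upwards [hnn n] with u hu using Real.enorm_of_nonneg hu
    simp [hint]
  exact (key.sub hb).congr (ae_of_all _ fun u => add_sub_cancel_right (f u) (b u))

end

theorem stmt_0 {Ω : Type*} [MeasurableSpace Ω] (ν : Measure Ω) [IsProbabilityMeasure ν]
    (σ : Ω → Ω) (hσ : Measurable σ)
    (hinv : ∀ A : Set Ω, MeasurableSet A → ν (σ ⁻¹' A) = ν A)
    (φ ζ : Ω → ℝ) (hφ : Measurable φ) (hζ : Measurable ζ)
    (hζint : Integrable ζ ν)
    (h : ∀ᵐ u ∂ν, φ (σ u) - φ u ≥ -ζ u) :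
    Integrable (fun u => φ (σ u) - φ u) ν ∧ ∫ u, (φ (σ u) - φ u) ∂ν = 0 := by
  have hpres : MeasurePreserving σ ν ν :=
    ⟨hσ, Measure.ext fun A hA => by rw [Measure.map_apply hσ hA, hinv A hA]⟩
  have hF (n : ℕ) : Integrable (fun u => truncate n (φ (σ u)) - truncate n (φ u)) ν :=
    (integrable_truncate_comp (hφ.comp hσ) n).sub (integrable_truncate_comp hφ n)
  have hF0 (n : ℕ) : ∫ u, (truncate n (φ (σ u)) - truncate n (φ u)) ∂ν = 0 :=
    hpres.integral_comp_sub_eq_zero (integrable_truncate_comp hφ n)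
  have hlim : ∀ᵐ u ∂ν, Tendsto (fun n => truncate n (φ (σ u)) - truncate n (φ u)) atTop
      (𝓝 (φ (σ u) - φ u)) :=
    ae_of_all _ fun u => (tendsto_truncate _).sub (tendsto_truncate _)
  have hint : Integrable (fun u => φ (σ u) - φ u) ν :=
    integrable_of_tendsto_of_integral_eq_zero hF hF0 hζint.abs
      (fun n => h.mono fun u hu => neg_abs_le_truncate_sub n hu) hlim
  refine ⟨hint, ?_⟩
  have hconv := tendsto_integral_of_dominated_convergence _ (fun n => (hF n).aestronglyMeasurable)
    hint.abs (fun n => ae_of_all _ fun u => abs_truncate_sub_le n _ _) hlim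
  simp only [hF0] at hconv
  exact tendsto_nhds_unique hconv tendsto_const_nhds
end

section
/- Let (Ω, F, ν) be a probability space, let σ : Ω → Ω be a measurable map which preserves ν, and let f, z, w, d : Ω → ℝ be measurable functions such that z ≥ 0, w ≥ 0, d ≥ 0 pointwise, z is ν-integrable, and the identity w − z = f∘σ − f − d holds pointwise on Ω. Then w and d are ν-integrable and ∫_Ω z dν = ∫_Ω w dν + ∫_Ω d dν. -/
open MeasureTheory

open Filter Topology in
/-- A real number is the limit of its truncations at levels `-n` and `n`. -/
theorem tendsto_clamp_natCast (t : ℝ) :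
    Tendsto (fun n : ℕ => max (-(n : ℝ)) (min t n)) atTop (𝓝 t) := by
  refine tendsto_const_nhds.congr' ?_
  filter_upwards [eventually_ge_atTop ⌈|t|⌉₊] with n hn
  have h := abs_le.1 (Nat.ceil_le.1 hn)
  rw [min_eq_left h.2, max_eq_right h.1]

theorem abs_clamp_sub_clamp_le (c a b : ℝ) :
    |max (-c) (min a c) - max (-c) (min b c)| ≤ |a - b| := by
  grind

theorem neg_le_clamp_sub_clamp {c a b e : ℝ} (he : 0 ≤ e) (h : -e ≤ a - b) :
    -e ≤ max (-c) (min a c) - max (-c) (min b c) := by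
  grind

open Filter Topology in
/-- If `f ∘ σ - f` is bounded below by minus an integrable nonnegative function, then it is
integrable with zero integral, even though `f` itself need not be integrable. -/
theorem MeasureTheory.MeasurePreserving.integrable_comp_sub_self_and_integral_eq_zero
    {Ω : Type*} [MeasurableSpace Ω] {ν : Measure Ω} [IsFiniteMeasure ν] {σ : Ω → Ω}
    (hσ : MeasurePreserving σ ν ν) {f z : Ω → ℝ} (hf : Measurable f) (hz0 : ∀ u, 0 ≤ z u)
    (hz : Integrable z ν) (hfz : ∀ u, -z u ≤ f (σ u) - f u) :
    Integrable (fun u => f (σ u) - f u) ν ∧ ∫ u, (f (σ u) - f u) ∂ν = 0 := by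
  set F : ℕ → Ω → ℝ := fun n u => max (-(n : ℝ)) (min (f u) n)
  have hFm (n) : Measurable (F n) := by fun_prop
  have hFint (n) : Integrable (F n) ν := by
    refine Integrable.of_bound (hFm n).aestronglyMeasurable (n : ℝ) (ae_of_all _ fun u => ?_)
    have hn : (0 : ℝ) ≤ n := n.cast_nonneg
    exact abs_le.2 ⟨le_max_left _ _, max_le (by linarith) (min_le_right _ _)⟩
  have hFσ (n) : Integrable (fun u => F n (σ u)) ν := hσ.integrable_comp_of_integrable (hFint n)
  have hGint (n) : Integrable (fun u => F n (σ u) - F n u) ν := (hFσ n).sub (hFint n)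
  have hGzint (n) : Integrable (fun u => F n (σ u) - F n u + z u) ν := (hGint n).add hz
  have hG0 (n) : ∫ u, (F n (σ u) - F n u) ∂ν = 0 := by
    have hmap : ∫ u, F n (σ u) ∂ν = ∫ u, F n u ∂ν := by
      conv_rhs => rw [← hσ.map_eq]
      exact (integral_map hσ.measurable.aemeasurable (hFm n).aestronglyMeasurable).symm
    rw [integral_sub (hFσ n) (hFint n), hmap, sub_self]
  have hlim (u) : Tendsto (fun n => F n (σ u) - F n u) atTop (𝓝 (f (σ u) - f u)) :=
    (tendsto_clamp_natCast _).sub (tendsto_clamp_natCast _)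
  have hnorm (n) : eLpNorm (fun u => F n (σ u) - F n u + z u) 1 ν
      = ENNReal.ofReal (∫ u, z u ∂ν) := by
    rw [eLpNorm_one_eq_lintegral_enorm, ← ofReal_integral_norm_eq_lintegral_enorm (hGzint n)]
    congr 1
    calc ∫ u, ‖F n (σ u) - F n u + z u‖ ∂ν = ∫ u, (F n (σ u) - F n u + z u) ∂ν :=
          integral_congr_ae (ae_of_all _ fun u => Real.norm_of_nonneg (by
            linarith [neg_le_clamp_sub_clamp (c := n) (hz0 u) (hfz u)]))
      _ = ∫ u, z u ∂ν := by rw [integral_add (hGint n) hz, hG0, zero_add]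
  have hsum : Integrable (fun u => f (σ u) - f u + z u) ν := by
    refine memLp_one_iff_integrable.1
      ⟨((hf.comp hσ.measurable).sub hf).aestronglyMeasurable.add hz.1, ?_⟩
    have hle := Lp.eLpNorm_lim_le_liminf_eLpNorm (p := 1)
      (fun n => (hGzint n).aestronglyMeasurable) (fun u => f (σ u) - f u + z u)
      (ae_of_all ν fun u => (hlim u).add_const (z u))
    refine hle.trans_lt ?_
    simp [hnorm]
  have hint : Integrable (fun u => f (σ u) - f u) ν := by
    simpa [Pi.sub_def] using hsum.sub hz
  have htendsto := tendsto_integral_of_dominated_convergence (fun u => |f (σ u) - f u|)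
    (fun n => (hGint n).aestronglyMeasurable) hint.abs
    (fun n => ae_of_all ν fun u => abs_clamp_sub_clamp_le n (f (σ u)) (f u))
    (ae_of_all ν hlim)
  simp only [hG0] at htendsto
  exact ⟨hint, tendsto_nhds_unique htendsto tendsto_const_nhds⟩

theorem stmt_1 {Ω : Type*} [MeasurableSpace Ω] (ν : Measure Ω) [IsProbabilityMeasure ν]
    (σ : Ω → Ω) (hσ : Measurable σ)
    (hinv : ∀ A : Set Ω, MeasurableSet A → ν (σ ⁻¹' A) = ν A)
    (f z w d : Ω → ℝ) (hf : Measurable f) (hz : Measurable z) (hw : Measurable w)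
    (hd : Measurable d)
    (hz0 : ∀ u, 0 ≤ z u) (hw0 : ∀ u, 0 ≤ w u) (hd0 : ∀ u, 0 ≤ d u)
    (hzint : Integrable z ν)
    (hbal : ∀ u, w u - z u = f (σ u) - f u - d u) :
    Integrable w ν ∧ Integrable d ν ∧ ∫ u, z u ∂ν = ∫ u, w u ∂ν + ∫ u, d u ∂ν := by
  have hpres : MeasurePreserving σ ν ν :=
    ⟨hσ, Measure.ext fun A hA => by rw [Measure.map_apply hσ hA, hinv A hA]⟩
  obtain ⟨hint, hzero⟩ := hpres.integrable_comp_sub_self_and_integral_eq_zero hf hz0 hzint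
    fun u => by linarith [hbal u, hw0 u, hd0 u]
  have hsum : Integrable (fun u => f (σ u) - f u + z u) ν := hint.add hzint
  have hwint : Integrable w ν := hsum.mono' hw.aestronglyMeasurable <| ae_of_all _ fun u => by
    rw [Real.norm_of_nonneg (hw0 u)]
    linarith [hbal u, hd0 u]
  have hdint : Integrable d ν := hsum.mono' hd.aestronglyMeasurable <| ae_of_all _ fun u => by
    rw [Real.norm_of_nonneg (hd0 u)]
    linarith [hbal u, hw0 u]
  refine ⟨hwint, hdint, ?_⟩
  calc ∫ u, z u ∂ν = ∫ u, (f (σ u) - f u + z u) ∂ν := by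
        rw [integral_add hint hzint, hzero, zero_add]
    _ = ∫ u, (w u + d u) ∂ν := integral_congr_ae (ae_of_all _ fun u => by
        linarith [hbal u])
    _ = ∫ u, w u ∂ν + ∫ u, d u ∂ν := integral_add hwint hdint
end

section
/- Let X be a nonempty compact metric space, let T : X → X be a continuous map, and let z : X → ℝ be a Borel measurable function with z ≥ 0 pointwise and z∘T ≤ z pointwise. Suppose ν is a T-invariant Borel probability measure on X and x ∈ supp ν. Then there exists a T-invariant Borel probability measure ν̃ on X such that x ∈ supp ν̃ and ∫_X z dν̃ < ∞. -/
open MeasureTheory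

/-- The support of a Borel measure: the set of points all of whose open
neighbourhoods have positive measure. -/
def measSupport {X : Type*} [TopologicalSpace X] [MeasurableSpace X]
    (μ : Measure X) : Set X :=
  {x | ∀ U : Set X, IsOpen U → x ∈ U → 0 < μ U}

/-- An integrable density which does not decrease along a measure-preserving map is almost everywhere
invariant, so the map preserves the weighted measure as well. -/
theorem MeasureTheory.MeasurePreserving.withDensity_of_le_comp {X : Type*} [MeasurableSpace X]
    {ν : Measure X} {T : X → X} (hT : MeasurePreserving T ν ν) {w : X → ENNReal}
    (hw : Measurable w) (hfin : ∫⁻ u, w u ∂ν ≠ ⊤) (hle : ∀ u, w u ≤ w (T u)) :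
    MeasurePreserving T (ν.withDensity w) (ν.withDensity w) := by
  have hae : w =ᵐ[ν] fun u => w (T u) :=
    ae_eq_of_ae_le_of_lintegral_le (ae_of_all _ hle) hfin (hw.comp hT.measurable).aemeasurable
      (hT.lintegral_comp hw).le
  refine ⟨hT.measurable, Measure.ext fun A hA => ?_⟩
  rw [Measure.map_apply hT.measurable hA, withDensity_apply _ (hT.measurable hA),
    withDensity_apply _ hA, ← hT.setLIntegral_comp_preimage hA hw]
  exact lintegral_congr_ae (ae_restrict_of_ae hae)

theorem stmt_3 {X : Type*} [MetricSpace X] [CompactSpace X] [Nonempty X]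
    [MeasurableSpace X] [BorelSpace X]
    (T : X → X) (hT : Continuous T)
    (z : X → ℝ) (hz : Measurable z) (hz0 : ∀ u, 0 ≤ z u) (hzT : ∀ u, z (T u) ≤ z u)
    (ν : Measure X) [IsProbabilityMeasure ν]
    (hνinv : ∀ A : Set X, MeasurableSet A → ν (T ⁻¹' A) = ν A)
    (x : X) (hx : x ∈ measSupport ν) :
    ∃ ν' : Measure X, IsProbabilityMeasure ν' ∧
      (∀ A : Set X, MeasurableSet A → ν' (T ⁻¹' A) = ν' A) ∧
      x ∈ measSupport ν' ∧ ∫⁻ u, ENNReal.ofReal (z u) ∂ν' < ⊤ := by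
  set w : X → ENNReal := fun u => ENNReal.ofReal (1 + z u)⁻¹ with hw_def
  have hw : Measurable w := (hz.const_add 1).inv.ennreal_ofReal
  have hpos : ∀ u, 0 < 1 + z u := fun u => by linarith [hz0 u]
  have hw_pos : ∀ u, w u ≠ 0 := fun u => (ENNReal.ofReal_pos.2 (inv_pos.2 (hpos u))).ne'
  have hw_le : ∀ u, w u ≤ w (T u) := fun u =>
    ENNReal.ofReal_le_ofReal (inv_anti₀ (hpos _) (by linarith [hzT u]))
  have hw_one : ∀ u, w u ≤ 1 := fun u =>
    ENNReal.ofReal_le_one.2 (inv_le_one_of_one_le₀ (by linarith [hz0 u]))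
  have hzw : ∀ u, w u * ENNReal.ofReal (z u) ≤ 1 := fun u => by
    rw [hw_def, ← ENNReal.ofReal_mul (inv_pos.2 (hpos u)).le]
    exact ENNReal.ofReal_le_one.2 ((inv_mul_le_one₀ (hpos u)).2 (by linarith))
  have lintegral_lt_top : ∀ f : X → ENNReal, (∀ u, f u ≤ 1) → ∫⁻ u, f u ∂ν < ⊤ := fun f hf =>
    (lintegral_mono hf).trans_lt (by simp)
  have hinv : MeasurePreserving T ν ν :=
    ⟨hT.measurable, Measure.ext fun A hA => by rw [Measure.map_apply hT.measurable hA, hνinv A hA]⟩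
  have hw_fin := (lintegral_lt_top w hw_one).ne
  have hpres := hinv.withDensity_of_le_comp hw hw_fin hw_le
  set m := ν.withDensity w with hm
  have hac : ν ≪ m := withDensity_absolutelyContinuous' hw.aemeasurable (ae_of_all _ hw_pos)
  have : IsFiniteMeasure m := isFiniteMeasure_withDensity hw_fin
  have : NeZero m := ⟨fun h => NeZero.ne ν (by
    rw [h] at hac; exact Measure.absolutelyContinuous_zero_iff.1 hac)⟩
  refine ⟨(m Set.univ)⁻¹ • m, inferInstance, fun A hA => ?_, fun U hU hxU => ?_, ?_⟩
  · simp only [Measure.smul_apply, hpres.measure_preimage hA.nullMeasurableSet]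
  · rw [Measure.smul_apply, smul_eq_mul]
    exact ENNReal.mul_pos (ENNReal.inv_ne_zero.2 (measure_ne_top m _))
      fun h => (hx U hU hxU).ne' (hac h)
  · rw [lintegral_smul_measure, smul_eq_mul, hm,
      lintegral_withDensity_eq_lintegral_mul _ hw hz.ennreal_ofReal, ← hm]
    exact ENNReal.mul_lt_top (ENNReal.inv_lt_top.2 (Measure.measure_univ_pos.2 (NeZero.ne m)))
      (lintegral_lt_top _ hzw)
end

section
/- Let X be a nonempty compact metric space and T : X → X a continuous map. Define the ergodic attractor E := ⋃ { supp μ : μ a T-invariant Borel probability measure on X }. Then E is a closed (hence compact) subset of X. -/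
open MeasureTheory

/-- The geometric average of a sequence of measures. -/
noncomputable def geometricAverage {X : Type*} [MeasurableSpace X] (μ : ℕ → Measure X) :
    Measure X :=
  Measure.sum fun n => (2⁻¹ : ENNReal) ^ (n + 1) • μ n

theorem geometricAverage_apply {X : Type*} [MeasurableSpace X] (μ : ℕ → Measure X)
    {A : Set X} (hA : MeasurableSet A) :
    geometricAverage μ A = ∑' n, (2⁻¹ : ENNReal) ^ (n + 1) * μ n A := by
  simp [geometricAverage, Measure.sum_apply _ hA]

theorem isProbabilityMeasure_geometricAverage {X : Type*} [MeasurableSpace X]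
    (μ : ℕ → Measure X) (hμ : ∀ n, IsProbabilityMeasure (μ n)) :
    IsProbabilityMeasure (geometricAverage μ) := by
  constructor
  rw [geometricAverage_apply μ MeasurableSet.univ]
  simp only [measure_univ, mul_one]
  rw [ENNReal.tsum_geometric_add_one, ENNReal.one_sub_inv_two, inv_inv]
  exact ENNReal.inv_mul_cancel two_ne_zero ENNReal.ofNat_ne_top

theorem geometricAverage_pos {X : Type*} [MeasurableSpace X] (μ : ℕ → Measure X)
    {A : Set X} (hA : MeasurableSet A) {n : ℕ} (h : 0 < μ n A) :
    0 < geometricAverage μ A := by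
  rw [geometricAverage_apply μ hA]
  refine lt_of_lt_of_le ?_ (ENNReal.le_tsum n)
  exact ENNReal.mul_pos (pow_ne_zero _ (by simp)) h.ne'

theorem stmt_5 {X : Type*} [MetricSpace X] [CompactSpace X] [Nonempty X]
    [MeasurableSpace X] [BorelSpace X]
    (T : X → X) (hT : Continuous T) :
    IsClosed {x : X | ∃ μ : Measure X, IsProbabilityMeasure μ ∧
        (∀ A : Set X, MeasurableSet A → μ (T ⁻¹' A) = μ A) ∧ x ∈ measSupport μ} ∧
    IsCompact {x : X | ∃ μ : Measure X, IsProbabilityMeasure μ ∧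
        (∀ A : Set X, MeasurableSet A → μ (T ⁻¹' A) = μ A) ∧ x ∈ measSupport μ} := by
  suffices h : IsClosed {x : X | ∃ μ : Measure X, IsProbabilityMeasure μ ∧
      (∀ A : Set X, MeasurableSet A → μ (T ⁻¹' A) = μ A) ∧ x ∈ measSupport μ} from
    ⟨h, h.isCompact⟩
  refine isClosed_of_closure_subset fun x hx => ?_
  obtain ⟨u, hu, hux⟩ := mem_closure_iff_seq_limit.1 hx
  choose μ hprob hinv hsupp using hu
  refine ⟨geometricAverage μ, isProbabilityMeasure_geometricAverage μ hprob,
    fun A hA => ?_, fun U hU hxU => ?_⟩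
  · rw [geometricAverage_apply μ hA, geometricAverage_apply μ (hT.measurable hA)]
    simp only [hinv _ A hA]
  · obtain ⟨n, hn⟩ := (hux.eventually (hU.mem_nhds hxU)).exists
    exact geometricAverage_pos μ hU.measurableSet (hsupp n U hU hn)
end

section
/- Let X be a nonempty compact metric space, T : X → X a continuous map, and u ∈ X. Define the ω-limit set on average ω̄(u) := { v ∈ X : for every open neighbourhood U of v, limsup_{n→∞} (1/n) ∑_{k=0}^{n-1} 1_U(T^k u) > 0 }, and the ω-limit set ω(u) := { v ∈ X : T^{n_k} u → v for some strictly increasing sequence (n_k) of natural numbers }. Then ω̄(u) is nonempty, compact, satisfies T(ω̄(u)) ⊆ ω̄(u), and ω̄(u) ⊆ ω(u). -/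
open MeasureTheory Filter

/-- The ω-limit set on average of a point `u` under the map `T`: points every open
neighbourhood of which is visited by the orbit of `u` with positive upper density. -/
def avgOmegaLimit {X : Type*} [TopologicalSpace X] (T : X → X) (u : X) : Set X :=
  {v | ∀ U : Set X, IsOpen U → v ∈ U →
    0 < limsup (fun n : ℕ =>
      (1 / (n : ℝ)) * ∑ k ∈ Finset.range n, Set.indicator U (fun _ => (1 : ℝ)) (T^[k] u)) atTop}

/-- The ω-limit set of a point `u` under the map `T`. -/
def omegaLimitSet {X : Type*} [TopologicalSpace X] (T : X → X) (u : X) : Set X :=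
  {v | ∃ n : ℕ → ℕ, StrictMono n ∧ Tendsto (fun k => T^[n k] u) atTop (nhds v)}

/-- The proportion of the first `n` points of the orbit of `u` under `T` lying in `U`. -/
noncomputable def visitFreq {X : Type*} (T : X → X) (u : X) (U : Set X) (n : ℕ) : ℝ :=
  (1 / (n : ℝ)) * ∑ k ∈ Finset.range n, Set.indicator U (fun _ => (1 : ℝ)) (T^[k] u)

section VisitFreq

variable {X : Type*} (T : X → X) (u : X)

lemma visitFreq_nonneg (U : Set X) (n : ℕ) : 0 ≤ visitFreq T u U n :=
  mul_nonneg (by positivity)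
    (Finset.sum_nonneg fun _ _ => Set.indicator_nonneg (fun _ _ => zero_le_one) _)

lemma visitFreq_mono {U V : Set X} (h : U ⊆ V) (n : ℕ) :
    visitFreq T u U n ≤ visitFreq T u V n :=
  mul_le_mul_of_nonneg_left
    (Finset.sum_le_sum fun _ _ =>
      Set.indicator_le_indicator_of_subset h (fun _ => zero_le_one) _) (by positivity)

lemma visitFreq_univ {n : ℕ} (hn : n ≠ 0) : visitFreq T u Set.univ n = 1 := by
  simp [visitFreq, hn]

lemma visitFreq_le_one (U : Set X) (n : ℕ) : visitFreq T u U n ≤ 1 := by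
  rcases eq_or_ne n 0 with rfl | hn
  · simp [visitFreq]
  · exact (visitFreq_mono T u (Set.subset_univ U) n).trans (visitFreq_univ T u hn).le

lemma visitFreq_union_le (U V : Set X) (n : ℕ) :
    visitFreq T u (U ∪ V) n ≤ visitFreq T u U n + visitFreq T u V n := by
  unfold visitFreq
  rw [← mul_add, ← Finset.sum_add_distrib]
  refine mul_le_mul_of_nonneg_left (Finset.sum_le_sum fun k _ => ?_) (by positivity)
  by_cases hU : T^[k] u ∈ U <;> by_cases hV : T^[k] u ∈ V <;> simp [hU, hV]

lemma visitFreq_preimage_le (U : Set X) (n : ℕ) :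
    visitFreq T u (T ⁻¹' U) n ≤ visitFreq T u U n + 1 / (n : ℝ) := by
  set f : ℕ → ℝ := fun k => Set.indicator U (fun _ => (1 : ℝ)) (T^[k] u) with hf
  have hshift : ∀ k, Set.indicator (T ⁻¹' U) (fun _ => (1 : ℝ)) (T^[k] u) = f (k + 1) := by
    intro k
    simp only [hf, Function.iterate_succ_apply']
    rfl
  have h0 : 0 ≤ f 0 := Set.indicator_nonneg (fun _ _ => zero_le_one) _
  have h1 : f n ≤ 1 := Set.indicator_le_self' (fun _ _ => zero_le_one) _
  have hsum : ∑ k ∈ Finset.range n, f (k + 1) ≤ ∑ k ∈ Finset.range n, f k + 1 := by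
    have := Finset.sum_range_succ f n
    have := Finset.sum_range_succ' f n
    linarith
  calc visitFreq T u (T ⁻¹' U) n
      = (1 / (n : ℝ)) * ∑ k ∈ Finset.range n, f (k + 1) := by simp only [visitFreq, hshift]
    _ ≤ (1 / (n : ℝ)) * (∑ k ∈ Finset.range n, f k + 1) :=
        mul_le_mul_of_nonneg_left hsum (by positivity)
    _ = visitFreq T u U n + 1 / (n : ℝ) := by simp only [visitFreq, hf]; ring

lemma limsup_visitFreq_pos_iff (U : Set X) :
    0 < limsup (visitFreq T u U) atTop ↔ ¬ Tendsto (visitFreq T u U) atTop (nhds 0) := by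
  have hle : IsBoundedUnder (· ≤ ·) atTop (visitFreq T u U) :=
    isBoundedUnder_of ⟨1, visitFreq_le_one T u U⟩
  have hge : IsBoundedUnder (· ≥ ·) atTop (visitFreq T u U) :=
    isBoundedUnder_of ⟨0, visitFreq_nonneg T u U⟩
  refine ⟨fun h ht => h.ne' ht.limsup_eq, fun h => ?_⟩
  contrapose! h
  exact tendsto_of_le_liminf_of_limsup_le
    (le_liminf_of_le hle.isCoboundedUnder_ge (Eventually.of_forall (visitFreq_nonneg T u U)))
    h hle hge

variable {T u}

lemma tendsto_visitFreq_zero_mono {U V : Set X} (h : U ⊆ V)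
    (hV : Tendsto (visitFreq T u V) atTop (nhds 0)) :
    Tendsto (visitFreq T u U) atTop (nhds 0) :=
  squeeze_zero (visitFreq_nonneg T u U) (visitFreq_mono T u h) hV

lemma tendsto_visitFreq_zero_of_eventually_notMem {U : Set X}
    (h : ∀ᶠ k in atTop, T^[k] u ∉ U) : Tendsto (visitFreq T u U) atTop (nhds 0) := by
  have h0 : Tendsto (fun k => Set.indicator U (fun _ => (1 : ℝ)) (T^[k] u)) atTop (nhds 0) :=
    tendsto_const_nhds.congr' (h.mono fun k hk => (Set.indicator_of_notMem hk _).symm)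
  exact h0.cesaro.congr fun n => by rw [visitFreq, one_div]

variable [TopologicalSpace X]

lemma mem_avgOmegaLimit_iff {v : X} :
    v ∈ avgOmegaLimit T u ↔
      ∀ U, IsOpen U → v ∈ U → ¬ Tendsto (visitFreq T u U) atTop (nhds 0) :=
  forall₃_congr fun U _ _ => limsup_visitFreq_pos_iff T u U

lemma avgOmegaLimit_nonempty [CompactSpace X] : (avgOmegaLimit T u).Nonempty := by
  by_contra hne
  rw [Set.not_nonempty_iff_eq_empty] at hne
  have huniv : Tendsto (visitFreq T u Set.univ) atTop (nhds 0) := by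
    refine isCompact_univ.induction_on (p := fun s => Tendsto (visitFreq T u s) atTop (nhds 0))
      ?_ (fun s t => tendsto_visitFreq_zero_mono) (fun s t hs ht => ?_) (fun v _ => ?_)
    · exact tendsto_visitFreq_zero_of_eventually_notMem (by simp)
    · exact squeeze_zero (visitFreq_nonneg T u _) (visitFreq_union_le T u s t)
        (by simpa using hs.add ht)
    · have hv : v ∉ avgOmegaLimit T u := by simp [hne]
      rw [mem_avgOmegaLimit_iff] at hv
      push Not at hv
      obtain ⟨U, hU, hvU, h⟩ := hv
      exact ⟨U, mem_nhdsWithin_of_mem_nhds (hU.mem_nhds hvU), h⟩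
  have hone : Tendsto (visitFreq T u Set.univ) atTop (nhds 1) :=
    tendsto_const_nhds.congr'
      ((eventually_ne_atTop 0).mono fun n hn => (visitFreq_univ T u hn).symm)
  exact zero_ne_one (tendsto_nhds_unique huniv hone)

lemma isClosed_avgOmegaLimit : IsClosed (avgOmegaLimit T u) := by
  refine isClosed_of_closure_subset fun v hv U hU hvU => ?_
  obtain ⟨w, hwU, hw⟩ := mem_closure_iff.1 hv U hU hvU
  exact hw U hU hwU

lemma image_avgOmegaLimit_subset (hT : Continuous T) :
    T '' avgOmegaLimit T u ⊆ avgOmegaLimit T u := by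
  rintro _ ⟨v, hv, rfl⟩
  rw [mem_avgOmegaLimit_iff] at hv ⊢
  intro U hU hvU h
  refine hv (T ⁻¹' U) (hU.preimage hT) hvU ?_
  exact squeeze_zero (visitFreq_nonneg T u _) (visitFreq_preimage_le T u U)
    (by simpa using h.add (tendsto_one_div_atTop_nhds_zero_nat (𝕜 := ℝ)))

lemma avgOmegaLimit_subset_omegaLimitSet [FirstCountableTopology X] :
    avgOmegaLimit T u ⊆ omegaLimitSet T u := by
  intro v hv
  rw [mem_avgOmegaLimit_iff] at hv
  have hcluster : MapClusterPt v atTop (fun k => T^[k] u) := by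
    rw [mapClusterPt_iff_frequently]
    intro s hs
    obtain ⟨U, hUs, hU, hvU⟩ := mem_nhds_iff.1 hs
    have hfreq : ∃ᶠ k in atTop, T^[k] u ∈ U := fun h =>
      hv U hU hvU (tendsto_visitFreq_zero_of_eventually_notMem h)
    exact hfreq.mono fun k hk => hUs hk
  exact hcluster.tendsto_subseq

end VisitFreq

theorem stmt_8 {X : Type*} [MetricSpace X] [CompactSpace X] [Nonempty X]
    (T : X → X) (hT : Continuous T) (u : X) :
    (avgOmegaLimit T u).Nonempty ∧ IsCompact (avgOmegaLimit T u) ∧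
      T '' avgOmegaLimit T u ⊆ avgOmegaLimit T u ∧
      avgOmegaLimit T u ⊆ omegaLimitSet T u :=
  ⟨avgOmegaLimit_nonempty, isClosed_avgOmegaLimit.isCompact,
    image_avgOmegaLimit_subset hT, avgOmegaLimit_subset_omegaLimitSet⟩
end

section
/- Let X be a nonempty compact metric space, T : X → X a continuous map, and u, v ∈ X. Suppose that for every open neighbourhood U of v one has limsup_{n→∞} (1/n) ∑_{k=0}^{n-1} 1_U(T^k u) > 0. Then there exists a T-invariant Borel probability measure μ on X with v ∈ supp μ. -/
open MeasureTheory Filter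

open Topology

/-- The empirical measure of the first `n` points of the `T`-orbit of `u`. -/
noncomputable def empiricalMeasure {X : Type*} [MeasurableSpace X]
    (T : X → X) (u : X) (n : ℕ) : Measure X :=
  (n : ENNReal)⁻¹ • ∑ k ∈ Finset.range n, Measure.dirac (T^[k] u)

theorem isProbabilityMeasure_empiricalMeasure {X : Type*} [MeasurableSpace X]
    (T : X → X) (u : X) {n : ℕ} (hn : n ≠ 0) :
    IsProbabilityMeasure (empiricalMeasure T u n) := by
  constructor
  simp only [empiricalMeasure, Measure.smul_apply, Measure.finsetSum_apply, measure_univ,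
    Finset.sum_const, Finset.card_range, nsmul_eq_mul, mul_one, smul_eq_mul]
  exact ENNReal.inv_mul_cancel (by exact_mod_cast hn) (ENNReal.natCast_ne_top n)

theorem integral_empiricalMeasure {X : Type*} [MeasurableSpace X] [MeasurableSingletonClass X]
    (T : X → X) (u : X) (n : ℕ) (g : X → ℝ) :
    ∫ x, g x ∂(empiricalMeasure T u n) = birkhoffAverage ℝ T g n u := by
  rw [empiricalMeasure, integral_smul_measure, integral_finsetSum_measure]
  · simp [birkhoffAverage, birkhoffSum, integral_dirac]
  · intro k _
    exact integrable_dirac (by simp)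

/-- A weak limit of empirical measures along any filter of times tending to infinity is
invariant. -/
theorem map_eq_of_tendsto_empiricalMeasure {X : Type*} [MetricSpace X] [MeasurableSpace X]
    [BorelSpace X] {T : X → X} (hT : Continuous T) (u : X) {ι : Type*} {L : Filter ι} [L.NeBot]
    {t : ι → ℕ} (ht : Tendsto t L atTop) {P : ι → ProbabilityMeasure X}
    (hP : ∀ i, (P i : Measure X) = empiricalMeasure T u (t i))
    {μ : ProbabilityMeasure X} (hμ : Tendsto P L (𝓝 μ)) :
    (μ : Measure X).map T = μ := by
  have : IsProbabilityMeasure ((μ : Measure X).map T) :=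
    Measure.isProbabilityMeasure_map hT.aemeasurable
  refine ext_of_forall_integral_eq_of_IsFiniteMeasure fun f => ?_
  rw [integral_map hT.aemeasurable f.continuous.aestronglyMeasurable]
  rw [ProbabilityMeasure.tendsto_iff_forall_integral_tendsto] at hμ
  have h₁ := hμ f
  have h₂ := hμ (f.compContinuous ⟨T, hT⟩)
  simp only [hP, integral_empiricalMeasure] at h₁ h₂
  have h₃ := (tendsto_birkhoffAverage_apply_sub_birkhoffAverage ℝ (f := T) (g := f) (x := u)
    (f.isBounded_range.subset (Set.range_comp_subset_range (fun k => T^[k] u) f))).comp ht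
  refine sub_eq_zero.1 (tendsto_nhds_unique (h₂.sub h₁) (h₃.congr fun i => ?_))
  simp [birkhoffAverage, birkhoffSum, (Function.Commute.iterate_self T _).eq u]

/-- A closed set visited with positive upper density is charged by some invariant probability
measure. -/
theorem exists_invariant_measure_pos_of_frequently {X : Type*} [MetricSpace X] [CompactSpace X]
    [MeasurableSpace X] [BorelSpace X] {T : X → X} (hT : Continuous T) (u : X) {F : Set X}
    (hF : IsClosed F) {δ : ℝ} (hδ : 0 < δ)
    (h : ∃ᶠ n in atTop, δ ≤ birkhoffAverage ℝ T (F.indicator fun _ => (1 : ℝ)) n u) :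
    ∃ μ : Measure X, IsProbabilityMeasure μ ∧ μ.map T = μ ∧ 0 < μ F := by
  rw [← map_add_atTop_eq_nat 1, frequently_map] at h
  obtain ⟨L, hL⟩ := Ultrafilter.exists_le (h := frequently_mem_iff_neBot.1 h)
  let P : ℕ → ProbabilityMeasure X := fun n =>
    ⟨empiricalMeasure T u (n + 1), isProbabilityMeasure_empiricalMeasure T u n.succ_ne_zero⟩
  obtain ⟨μ, -, hμ⟩ := isCompact_univ.ultrafilter_le_nhds (L.map P) (by simp)
  have hμ : Tendsto P L (𝓝 μ) := hμ
  refine ⟨μ, inferInstance, map_eq_of_tendsto_empiricalMeasure hT u (t := fun n => n + 1)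
    ((tendsto_add_atTop_nat 1).mono_left (hL.trans inf_le_left)) (fun _ => rfl) hμ, ?_⟩
  refine (ENNReal.ofReal_pos.2 hδ).trans_le <| le_trans ?_
    (ProbabilityMeasure.limsup_measure_closed_le_of_tendsto hμ hF)
  have hmem : ∀ᶠ n in (L : Filter ℕ),
      δ ≤ birkhoffAverage ℝ T (F.indicator fun _ => (1 : ℝ)) (n + 1) u :=
    (hL.trans inf_le_right) (mem_principal_self _)
  refine le_limsup_of_frequently_le (hmem.mono fun n hn => ?_).frequently
  rw [← integral_empiricalMeasure, integral_indicator_const _ hF.measurableSet, smul_eq_mul,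
    mul_one] at hn
  exact ENNReal.ofReal_le_of_le_toReal hn

/-- Countably many invariant probability measures are simultaneously absolutely continuous with
respect to a single one. -/
theorem exists_invariant_measure_forall_absolutelyContinuous {X : Type*} [MeasurableSpace X]
    {T : X → X} (hT : Measurable T) (μ : ℕ → Measure X) [∀ n, IsProbabilityMeasure (μ n)]
    (hμ : ∀ n, (μ n).map T = μ n) :
    ∃ ν : Measure X, IsProbabilityMeasure ν ∧ ν.map T = ν ∧ ∀ n, μ n ≪ ν := by
  refine ⟨Measure.sum fun n => (2⁻¹ : ENNReal) ^ (n + 1) • μ n, ⟨?_⟩, ?_, fun n => ?_⟩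
  · simp only [Measure.sum_apply _ MeasurableSet.univ, Measure.smul_apply, measure_univ,
      smul_eq_mul, mul_one]
    rw [ENNReal.tsum_geometric_add_one, ENNReal.one_sub_inv_two, inv_inv]
    exact ENNReal.inv_mul_cancel two_ne_zero ENNReal.ofNat_ne_top
  · rw [Measure.map_sum hT.aemeasurable]
    simp only [Measure.map_smul, hμ]
  · refine Measure.absolutelyContinuous_sum_right n (Measure.absolutelyContinuous_smul ?_)
    exact pow_ne_zero _ (by simp)

theorem stmt_9 {X : Type*} [MetricSpace X] [CompactSpace X] [Nonempty X]
    [MeasurableSpace X] [BorelSpace X]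
    (T : X → X) (hT : Continuous T) (u v : X)
    (hv : ∀ U : Set X, IsOpen U → v ∈ U →
      0 < limsup (fun n : ℕ =>
        (1 / (n : ℝ)) * ∑ k ∈ Finset.range n,
          Set.indicator U (fun _ => (1 : ℝ)) (T^[k] u)) atTop) :
    ∃ μ : Measure X, IsProbabilityMeasure μ ∧
      (∀ A : Set X, MeasurableSet A → μ (T ⁻¹' A) = μ A) ∧ v ∈ measSupport μ := by
  have key : ∀ r : ℝ, 0 < r → ∃ μ : Measure X, IsProbabilityMeasure μ ∧ μ.map T = μ ∧
      0 < μ (Metric.closedBall v r) := by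
    intro r hr
    obtain ⟨δ, hδ, hlt⟩ := exists_between (hv _ Metric.isOpen_ball (Metric.mem_ball_self hr))
    have hbdd : IsBoundedUnder (· ≥ ·) atTop fun n : ℕ => (1 / (n : ℝ)) *
        ∑ k ∈ Finset.range n, (Metric.ball v r).indicator (fun _ => (1 : ℝ)) (T^[k] u) :=
      isBoundedUnder_of ⟨0, fun n => mul_nonneg (by positivity) <|
        Finset.sum_nonneg fun k _ => Set.indicator_nonneg (fun _ _ => zero_le_one) _⟩
    refine exists_invariant_measure_pos_of_frequently hT u Metric.isClosed_closedBall hδ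
      ((frequently_lt_of_lt_limsup hbdd.isCoboundedUnder_le hlt).mono fun n hn => hn.le.trans ?_)
    rw [birkhoffAverage, birkhoffSum, smul_eq_mul, one_div]
    gcongr
    exact Metric.ball_subset_closedBall
  choose μ hμ hinv hpos using fun n : ℕ => key (1 / ((n : ℝ) + 1)) Nat.one_div_pos_of_nat
  obtain ⟨ν, hν, hνinv, hac⟩ :=
    exists_invariant_measure_forall_absolutelyContinuous hT.measurable μ hinv
  refine ⟨ν, hν, fun A hA => by rw [← Measure.map_apply hT.measurable hA, hνinv],
    fun U hU hvU => ?_⟩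
  obtain ⟨ε, hε, hεU⟩ := Metric.isOpen_iff.1 hU v hvU
  obtain ⟨n, hn⟩ := exists_nat_one_div_lt hε
  refine pos_iff_ne_zero.2 fun h0 => (hpos n).ne' (measure_mono_null ?_ (hac n h0))
  exact (Metric.closedBall_subset_ball hn).trans hεU
end

section
/- Let X be a nonempty compact metric space and let S, T : X → X be continuous maps with S∘T = T∘S. Define E := ⋃ { supp μ : μ a Borel probability measure on X invariant under both S and T }. Let U be an open subset of X containing E. Then for every u ∈ X, lim_{n→∞} (1/n²) ∑_{j=0}^{n-1} ∑_{k=0}^{n-1} 1_U(S^j T^k u) = 1. -/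
open MeasureTheory Filter

open scoped ENNReal Topology BoundedContinuousFunction

/-- The uniform average of the Dirac masses at `x j k`, for `j, k ≤ n`. -/
noncomputable def squareAverage {X : Type*} [MeasurableSpace X] (x : ℕ → ℕ → X) (n : ℕ) :
    Measure X :=
  (((n + 1 : ℕ) : ℝ≥0∞) ^ 2)⁻¹ •
    ∑ j ∈ Finset.range (n + 1), ∑ k ∈ Finset.range (n + 1), Measure.dirac (x j k)

section SquareAverage

variable {X : Type*} [MeasurableSpace X]

lemma squareAverage_swap (x : ℕ → ℕ → X) (n : ℕ) :
    squareAverage (fun j k => x k j) n = squareAverage x n := by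
  rw [squareAverage, squareAverage, Finset.sum_comm]

instance isProbabilityMeasure_squareAverage (x : ℕ → ℕ → X) (n : ℕ) :
    IsProbabilityMeasure (squareAverage x n) := by
  constructor
  have h0 : (((n + 1 : ℕ) : ℝ≥0∞)) ^ 2 ≠ 0 := by positivity
  have ht : (((n + 1 : ℕ) : ℝ≥0∞)) ^ 2 ≠ ∞ := by finiteness
  simp only [squareAverage, Measure.smul_apply, Measure.finsetSum_apply, measure_univ,
    Finset.sum_const, Finset.card_range, smul_eq_mul, nsmul_eq_mul, mul_one]
  rw [← sq, ENNReal.inv_mul_cancel h0 ht]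

lemma integral_squareAverage (x : ℕ → ℕ → X) (n : ℕ) {g : X → ℝ} (hg : StronglyMeasurable g) :
    ∫ y, g y ∂squareAverage x n = (1 / ((n + 1 : ℕ) : ℝ) ^ 2) *
      ∑ j ∈ Finset.range (n + 1), ∑ k ∈ Finset.range (n + 1), g (x j k) := by
  have hint (j k : ℕ) : Integrable g (Measure.dirac (x j k)) :=
    integrable_dirac' hg (by simp [enorm_lt_top])
  rw [squareAverage, integral_smul_measure, integral_finsetSum_measure]
  · congr 1
    · rw [ENNReal.toReal_inv, ENNReal.toReal_pow, ENNReal.toReal_natCast, one_div]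
    · refine Finset.sum_congr rfl fun j _ => ?_
      rw [integral_finsetSum_measure fun k _ => hint j k]
      exact Finset.sum_congr rfl fun k _ => integral_dirac' _ _ hg
  · intro j _
    exact integrable_finsetSum_measure.2 fun k _ => hint j k

lemma measureReal_squareAverage (x : ℕ → ℕ → X) (n : ℕ) {U : Set X} (hU : MeasurableSet U) :
    (squareAverage x n).real U = (1 / ((n + 1 : ℕ) : ℝ) ^ 2) *
      ∑ j ∈ Finset.range (n + 1), ∑ k ∈ Finset.range (n + 1),
        U.indicator (fun _ => (1 : ℝ)) (x j k) := by
  rw [← integral_squareAverage x n (stronglyMeasurable_const.indicator hU),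
    integral_indicator_const _ hU, smul_eq_mul, mul_one]

variable [TopologicalSpace X] [BorelSpace X]

/-- Averages over a square along which `f` acts as a shift of the first index become
asymptotically `f`-invariant. -/
lemma tendsto_integral_comp_sub_squareAverage {x : ℕ → ℕ → X} {f : X → X} (hf : Continuous f)
    (hx : ∀ j k, f (x j k) = x (j + 1) k) (g : X →ᵇ ℝ) :
    Tendsto (fun n => ∫ y, g (f y) ∂squareAverage x n - ∫ y, g y ∂squareAverage x n)
      atTop (𝓝 0) := by
  have hlim : Tendsto (fun n : ℕ => 2 * ‖g‖ * (1 / ((n : ℝ) + 1))) atTop (𝓝 0) := by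
    simpa using tendsto_one_div_add_atTop_nhds_zero_nat.const_mul (2 * ‖g‖)
  refine squeeze_zero_norm (fun n => ?_) hlim
  have hpos : (0 : ℝ) < (n : ℝ) + 1 := by positivity
  have hgf : StronglyMeasurable fun y => g (f y) :=
    (g.continuous.comp hf).measurable.stronglyMeasurable
  rw [integral_squareAverage x n hgf,
    integral_squareAverage x n g.continuous.measurable.stronglyMeasurable, ← mul_sub,
    Finset.sum_comm, Finset.sum_comm (f := fun j k => g (x j k)), ← Finset.sum_sub_distrib]
  have htel (k : ℕ) : ∑ j ∈ Finset.range (n + 1), g (f (x j k)) -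
      ∑ j ∈ Finset.range (n + 1), g (x j k) = g (x (n + 1) k) - g (x 0 k) := by
    simp only [hx]
    rw [← Finset.sum_sub_distrib, Finset.sum_range_sub (fun j => g (x j k))]
  have hbound : ‖∑ k ∈ Finset.range (n + 1), (g (x (n + 1) k) - g (x 0 k))‖ ≤
      (n + 1) * (2 * ‖g‖) := by
    refine (norm_sum_le_of_le _ fun k _ => ?_).trans_eq (b := ∑ k ∈ Finset.range (n + 1), 2 * ‖g‖)
      (by simp)
    rw [← dist_eq_norm]
    exact g.dist_le_two_norm _ _
  simp only [htel]
  rw [norm_mul, Real.norm_of_nonneg (by positivity)]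
  push_cast
  calc _ ≤ 1 / ((n : ℝ) + 1) ^ 2 * ((n + 1) * (2 * ‖g‖)) := by gcongr
    _ = _ := by field_simp

variable [HasOuterApproxClosed X]

lemma map_eq_of_tendsto_squareAverage {x : ℕ → ℕ → X} {f : X → X} (hf : Continuous f)
    (hx : ∀ j k, f (x j k) = x (j + 1) k) {F : Filter ℕ} [F.NeBot] (hF : F ≤ atTop)
    {μs : ℕ → ProbabilityMeasure X} (hμs : ∀ n, (μs n : Measure X) = squareAverage x n)
    {μ : ProbabilityMeasure X} (hμ : Tendsto μs F (𝓝 μ)) :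
    (μ : Measure X).map f = μ := by
  rw [ProbabilityMeasure.tendsto_iff_forall_integral_tendsto] at hμ
  simp only [hμs] at hμ
  have : IsProbabilityMeasure ((μ : Measure X).map f) :=
    Measure.isProbabilityMeasure_map hf.aemeasurable
  refine ext_of_forall_integral_eq_of_IsFiniteMeasure fun g => ?_
  rw [integral_map hf.aemeasurable g.continuous.measurable.aestronglyMeasurable]
  exact sub_eq_zero.1 <| tendsto_nhds_unique
    ((hμ (g.compContinuous ⟨f, hf⟩)).sub (hμ g))
    ((tendsto_integral_comp_sub_squareAverage hf hx g).mono_left hF)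

lemma tendsto_measureReal_one_of_isOpen {ι : Type*} {F : Filter ι}
    {μs : ι → ProbabilityMeasure X} {μ : ProbabilityMeasure X} (hμ : Tendsto μs F (𝓝 μ))
    {U : Set X} (hU : IsOpen U) (hμU : (μ : Measure X) U = 1) :
    Tendsto (fun i => (μs i : Measure X).real U) F (𝓝 1) := by
  rcases F.eq_or_neBot with rfl | _
  · exact tendsto_bot
  have h : Tendsto (fun i => (μs i : Measure X) U) F (𝓝 1) :=
    tendsto_of_le_liminf_of_limsup_le
      (hμU ▸ ProbabilityMeasure.le_liminf_measure_open_of_tendsto hμ hU)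
      (limsup_le_of_le (by isBoundedDefault) (Eventually.of_forall fun _ => prob_le_one))
  simpa [Measure.real, Function.comp_def] using (ENNReal.tendsto_toReal ENNReal.one_ne_top).comp h

end SquareAverage

lemma prob_eq_one_of_measSupport_subset {X : Type*} [TopologicalSpace X]
    [SecondCountableTopology X] [MeasurableSpace X] [OpensMeasurableSpace X] {μ : Measure X}
    [IsProbabilityMeasure μ] {U : Set X} (hU : IsOpen U) (h : measSupport μ ⊆ U) : μ U = 1 := by
  rw [← prob_compl_eq_zero_iff hU.measurableSet]
  refine measure_null_of_locally_null _ fun x hx => ?_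
  have hx' : x ∉ measSupport μ := fun hxs => hx (h hxs)
  simp only [measSupport, Set.mem_ofPred_eq, not_forall, not_lt, nonpos_iff_eq_zero] at hx'
  obtain ⟨V, hV, hxV, hV0⟩ := hx'
  exact ⟨V, mem_nhdsWithin_of_mem_nhds (hV.mem_nhds hxV), hV0⟩

theorem stmt_13 {X : Type*} [MetricSpace X] [CompactSpace X] [Nonempty X]
    [MeasurableSpace X] [BorelSpace X]
    (S T : X → X) (hS : Continuous S) (hT : Continuous T) (hcomm : S ∘ T = T ∘ S)
    (U : Set X) (hU : IsOpen U)
    (hEU : {x : X | ∃ μ : Measure X, IsProbabilityMeasure μ ∧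
      (∀ A : Set X, MeasurableSet A → μ (S ⁻¹' A) = μ A) ∧
      (∀ A : Set X, MeasurableSet A → μ (T ⁻¹' A) = μ A) ∧ x ∈ measSupport μ} ⊆ U) :
    ∀ u : X, Tendsto (fun n : ℕ =>
      (1 / (n : ℝ) ^ 2) * ∑ j ∈ Finset.range n, ∑ k ∈ Finset.range n,
        Set.indicator U (fun _ => (1 : ℝ)) (S^[j] (T^[k] u))) atTop (nhds 1) := by
  intro u
  rw [← tendsto_add_atTop_iff_nat 1]
  set x : ℕ → ℕ → X := fun j k => S^[j] (T^[k] u) with hx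
  have hxS (j k : ℕ) : S (x j k) = x (j + 1) k := (Function.iterate_succ_apply' S j _).symm
  have hxT (j k : ℕ) : T (x k j) = x k (j + 1) := by
    have hc : Function.Commute S T := congrFun hcomm
    simp only [hx]
    rw [Function.iterate_succ_apply', (hc.iterate_left k).eq]
  let μs : ℕ → ProbabilityMeasure X := fun n => ⟨squareAverage x n, inferInstance⟩
  suffices h : Tendsto (fun n => (μs n : Measure X).real U) atTop (𝓝 1) from
    h.congr fun n => measureReal_squareAverage x n hU.measurableSet
  rw [tendsto_iff_ultrafilter]
  intro F hF
  obtain ⟨μ, -, hμ⟩ := isCompact_univ.ultrafilter_le_nhds (F.map μs) (by simp)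
  replace hμ : Tendsto μs F (𝓝 μ) := hμ
  have hμS : (μ : Measure X).map S = μ :=
    map_eq_of_tendsto_squareAverage hS hxS hF (fun _ => rfl) hμ
  have hμT : (μ : Measure X).map T = μ :=
    map_eq_of_tendsto_squareAverage (x := fun j k => x k j) (μs := μs) hT hxT hF
      (fun n => (squareAverage_swap x n).symm) hμ
  refine tendsto_measureReal_one_of_isOpen hμ hU (prob_eq_one_of_measSupport_subset hU ?_)
  refine fun y hy => hEU ⟨μ, inferInstance, fun A hA => ?_, fun A hA => ?_, hy⟩
  · rw [← Measure.map_apply hS.measurable hA, hμS]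
  · rw [← Measure.map_apply hT.measurable hA, hμT]
end

section
/- Let u : ℝ → ℝ be a continuously differentiable 1-periodic function, let y := ∫₀¹ u(x) dx, and let p ≥ 1 be an integer. Then ∫₀¹ (u(x) − y)^{2p} dx ≤ (p²/π²) ∫₀¹ (u(x) − y)^{2p−2} u′(x)² dx. -/
open intervalIntegral in
/-- Poincaré inequality with Dirichlet boundary conditions, with a nonoptimal constant. -/
theorem sq_mul_integral_sq_le_integral_deriv_sq {a b μ : ℝ} (hab : a ≤ b) (hμ : 0 ≤ μ)
    (hμπ : μ * (b - a) < Real.pi) {w w' : ℝ → ℝ} (hw : ∀ x, HasDerivAt w (w' x) x)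
    (hw' : Continuous w') (ha : w a = 0) (hb : w b = 0) :
    μ ^ 2 * ∫ x in a..b, w x ^ 2 ≤ ∫ x in a..b, w' x ^ 2 := by
  have hwc : Continuous w := continuous_iff_continuousAt.2 fun x => (hw x).continuousAt
  set T : ℝ → ℝ := fun x => μ * Real.tan (μ * (x - (a + b) / 2)) with hT
  have hcos : ∀ x ∈ Set.uIcc a b, Real.cos (μ * (x - (a + b) / 2)) ≠ 0 := by
    intro x hx
    rw [Set.uIcc_of_le hab] at hx
    have h1 := mul_le_mul_of_nonneg_left hx.1 hμ
    have h2 := mul_le_mul_of_nonneg_left hx.2 hμ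
    exact (Real.cos_pos_of_mem_Ioo ⟨by linarith, by linarith⟩).ne'
  have hTd : ∀ x ∈ Set.uIcc a b, HasDerivAt T (μ ^ 2 + T x ^ 2) x := by
    intro x hx
    have hc := hcos x hx
    have h1 : HasDerivAt (fun x => μ * (x - (a + b) / 2)) (μ * 1) x :=
      ((hasDerivAt_id x).sub_const _).const_mul μ
    have h2 := ((Real.hasDerivAt_tan hc).comp x h1).const_mul μ
    refine h2.congr_deriv ?_
    simp only [hT, Real.tan_eq_sin_div_cos]
    generalize μ * (x - (a + b) / 2) = θ at hc
    field_simp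
    linear_combination -μ ^ 2 * Real.sin_sq_add_cos_sq θ
  have hTc : ContinuousOn T (Set.uIcc a b) := fun x hx => (hTd x hx).continuousAt.continuousWithinAt
  have hG : ∀ x ∈ Set.uIcc a b, HasDerivAt (fun x => T x * w x ^ 2)
      ((w' x + T x * w x) ^ 2 - (w' x ^ 2 - μ ^ 2 * w x ^ 2)) x := by
    intro x hx
    refine ((hTd x hx).mul ((hw x).pow 2)).congr_deriv ?_
    simp only [Pi.pow_apply]
    push_cast
    ring
  have hi1 : IntervalIntegrable (fun x => (w' x + T x * w x) ^ 2) MeasureTheory.volume a b :=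
    ContinuousOn.intervalIntegrable
      ((hw'.continuousOn.add (hTc.mul hwc.continuousOn)).pow 2)
  have hi2 : IntervalIntegrable (fun x => w' x ^ 2) MeasureTheory.volume a b :=
    (hw'.pow 2).intervalIntegrable _ _
  have hi3 : IntervalIntegrable (fun x => μ ^ 2 * w x ^ 2) MeasureTheory.volume a b :=
    (continuous_const.mul (hwc.pow 2)).intervalIntegrable _ _
  have hFTC := integral_eq_sub_of_hasDerivAt hG (hi1.sub (hi2.sub hi3))
  rw [integral_sub hi1 (hi2.sub hi3), integral_sub hi2 hi3, integral_const_mul] at hFTC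
  have hnn : 0 ≤ ∫ x in a..b, (w' x + T x * w x) ^ 2 :=
    integral_nonneg hab fun x _ => sq_nonneg _
  simp only [ha, hb] at hFTC
  linarith

/-- Poincaré inequality with Dirichlet boundary conditions, with the optimal constant. -/
theorem pi_div_sq_mul_integral_sq_le_integral_deriv_sq {a b : ℝ} (hab : a < b) {w w' : ℝ → ℝ}
    (hw : ∀ x, HasDerivAt w (w' x) x) (hw' : Continuous w') (ha : w a = 0) (hb : w b = 0) :
    (Real.pi / (b - a)) ^ 2 * ∫ x in a..b, w x ^ 2 ≤ ∫ x in a..b, w' x ^ 2 := by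
  have hba : 0 < b - a := sub_pos.2 hab
  have hpos : 0 < Real.pi / (b - a) := div_pos Real.pi_pos hba
  have hlim : Filter.Tendsto (fun μ : ℝ => μ ^ 2 * ∫ x in a..b, w x ^ 2)
      (nhdsWithin (Real.pi / (b - a)) (Set.Iio (Real.pi / (b - a))))
      (nhds ((Real.pi / (b - a)) ^ 2 * ∫ x in a..b, w x ^ 2)) :=
    ((continuous_id.pow 2).mul continuous_const).continuousAt.continuousWithinAt
  refine le_of_tendsto hlim ?_
  filter_upwards [Ioo_mem_nhdsLT hpos] with μ hμ
  exact sq_mul_integral_sq_le_integral_deriv_sq hab.le hμ.1.le ((lt_div_iff₀ hba).1 hμ.2)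
    hw hw' ha hb

/-- Mean value theorem for the integral of a continuous function over the unit interval. -/
theorem exists_eq_integral_zero_one {u : ℝ → ℝ} (hu : Continuous u) :
    ∃ c, u c = ∫ x in (0 : ℝ)..1, u x := by
  have hd (x : ℝ) : HasDerivAt (fun t => ∫ s in (0 : ℝ)..t, u s) (u x) x :=
    hu.integral_hasStrictDerivAt 0 x |>.hasDerivAt
  obtain ⟨c, -, hc⟩ := exists_hasDerivAt_eq_slope _ u zero_lt_one
    (fun x _ => (hd x).continuousAt.continuousWithinAt) (fun x _ => hd x)
  exact ⟨c, by simpa using hc⟩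

theorem stmt_16 (u : ℝ → ℝ) (hu : ContDiff ℝ 1 u)
    (hper : ∀ x : ℝ, u (x + 1) = u x)
    (y : ℝ) (hy : y = ∫ x in (0:ℝ)..1, u x)
    (p : ℕ) (hp : 1 ≤ p) :
    ∫ x in (0:ℝ)..1, (u x - y) ^ (2 * p) ≤
      ((p : ℝ) ^ 2 / Real.pi ^ 2) *
        ∫ x in (0:ℝ)..1, (u x - y) ^ (2 * p - 2) * (deriv u x) ^ 2 := by
  obtain ⟨c, hc⟩ := exists_eq_integral_zero_one hu.continuous
  rw [← hy] at hc
  have hu' : Continuous (deriv u) := hu.continuous_deriv le_rfl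
  have hper' : ∀ x, deriv u (x + 1) = deriv u x := fun x => by
    rw [← deriv_comp_add_const, funext hper]
  have hw (x : ℝ) : HasDerivAt (fun x => (u x - y) ^ p)
      (p * (u x - y) ^ (p - 1) * deriv u x) x :=
    (((hu.differentiable one_ne_zero x).hasDerivAt).sub_const y).pow p
  have hp0 : p ≠ 0 := by omega
  have key := pi_div_sq_mul_integral_sq_le_integral_deriv_sq (lt_add_one c) hw
    ((continuous_const.mul ((hu.continuous.sub continuous_const).pow _)).mul hu')
    (by simp [hc, hp0]) (by simp [hper, hc, hp0])
  have hsq (x : ℝ) : ((u x - y) ^ p) ^ 2 = (u x - y) ^ (2 * p) := by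
    rw [← pow_mul, mul_comm]
  have hsq' (x : ℝ) : ((p : ℝ) * (u x - y) ^ (p - 1) * deriv u x) ^ 2 =
      (p : ℝ) ^ 2 * ((u x - y) ^ (2 * p - 2) * deriv u x ^ 2) := by
    rw [mul_pow, mul_pow, ← pow_mul, show (p - 1) * 2 = 2 * p - 2 by omega, mul_assoc]
  simp only [hsq, hsq', intervalIntegral.integral_const_mul, add_sub_cancel_left, div_one] at key
  have shift {f : ℝ → ℝ} (hf : Function.Periodic f 1) :
      ∫ x in c..c + 1, f x = ∫ x in (0 : ℝ)..1, f x := by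
    simpa using hf.intervalIntegral_add_eq c 0
  rw [shift fun x => by simp only [hper], shift fun x => by simp only [hper, hper']] at key
  rw [div_mul_eq_mul_div, le_div_iff₀ (by positivity), mul_comm]
  exact key
end
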